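/- Let m be a positive integer, j ≥ 1 an integer, and for each a ∈ {0, 1/(2m), …, (2m−1)/(2m)} let f_a : ℍ → ℂ be holomorphic. Then the j-fold iterate of the heat operator satisfies H_m^j( Σ_a f_a(τ) θ_{m,a}(τ,z) ) = (−16π²m)^j Σ_a D^j(f_a)(τ) θ_{m,a}(τ,z) for all (τ,z) ∈ ℍ×ℂ. -/

import Mathlib

open Complex

noncomputable section

/-- The index-`m` theta series `θ_{m,a}`. -/
def theta (m : ℕ) (a : ℝ) (τ z : ℂ) : ℂ :=
  ∑' n : ℤ, Complex.exp (2 * (Real.pi : ℂ) * Complex.I * (m : ℂ) *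
    (((n : ℂ) + (a : ℂ)) ^ 2 * τ + 2 * ((n : ℂ) + (a : ℂ)) * z))

/-- Holomorphic Wirtinger derivative. -/
def wder (f : ℂ → ℂ) (w : ℂ) : ℂ :=
  (fderiv ℝ f w 1 - Complex.I * fderiv ℝ f w Complex.I) / 2

/-- The index-`m` heat operator `H_m = 8πim ∂_τ − ∂_z²`. -/
def heatOp (m : ℕ) (F : ℂ → ℂ → ℂ) : ℂ → ℂ → ℂ :=
  fun τ z => 8 * (Real.pi : ℂ) * Complex.I * (m : ℂ) * wder (fun w => F w z) τ
    - wder (wder (F τ)) z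

/-- The operator `D = (1/(2πi)) ∂_τ`, as an operator on functions of `τ`. -/
def Dop : (ℂ → ℂ) → (ℂ → ℂ) :=
  fun f τ => wder f τ / (2 * (Real.pi : ℂ) * Complex.I)

open Filter Topology

/-- The general term of the theta series `θ_{m,a}`. -/
def thetaTerm (m : ℕ) (a : ℝ) (n : ℤ) (τ z : ℂ) : ℂ :=
  Complex.exp (2 * (Real.pi : ℂ) * Complex.I * (m : ℂ) *
    (((n : ℂ) + (a : ℂ)) ^ 2 * τ + 2 * ((n : ℂ) + (a : ℂ)) * z))

/-- A summable majorant of the general term of `θ_{m,a}` on `T ≤ im τ`, `|im z| ≤ S`. -/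
def thetaBound (m : ℕ) (a S T : ℝ) (n : ℤ) : ℝ :=
  Real.exp (4 * Real.pi * m * S * |a|) *
    Real.exp (-Real.pi * (2 * m * T * n ^ 2 - 2 * (2 * m * (T * |a| + S)) * |n|))

theorem wder_eq_deriv {f : ℂ → ℂ} {w : ℂ} (h : DifferentiableAt ℂ f w) :
    wder f w = deriv f w := by
  have hI : fderiv ℂ f w Complex.I = Complex.I * deriv f w := by
    rw [fderiv_eq_smul_deriv, smul_eq_mul]
  rw [wder, h.fderiv_restrictScalars ℝ]
  simp only [ContinuousLinearMap.coe_restrictScalars', hI, fderiv_apply_one_eq_deriv]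
  linear_combination (-(deriv f w) / 2) * Complex.I_mul_I

theorem wder_congr {f g : ℂ → ℂ} {w : ℂ} (h : f =ᶠ[𝓝 w] g) : wder f w = wder g w := by
  rw [wder, wder, h.fderiv_eq]

theorem isOpen_upperHalfPlane : IsOpen {τ : ℂ | 0 < τ.im} :=
  isOpen_lt continuous_const Complex.continuous_im

theorem heatOp_congr {m : ℕ} {F G : ℂ → ℂ → ℂ}
    (h : ∀ τ z : ℂ, 0 < τ.im → F τ z = G τ z) {τ : ℂ} (hτ : 0 < τ.im) (z : ℂ) :
    heatOp m F τ z = heatOp m G τ z := by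
  have h1 : (fun w => F w z) =ᶠ[𝓝 τ] fun w => G w z :=
    eventually_of_mem (isOpen_upperHalfPlane.mem_nhds hτ) fun w hw => h w z hw
  have h2 : F τ = G τ := funext fun y => h τ y hτ
  rw [heatOp, heatOp, wder_congr h1, h2]

theorem Dop_eqOn {f : ℂ → ℂ} (hf : DifferentiableOn ℂ f {τ : ℂ | 0 < τ.im}) :
    Set.EqOn (Dop f) (fun τ => deriv f τ / (2 * (Real.pi : ℂ) * Complex.I))
      {τ : ℂ | 0 < τ.im} := by
  intro τ hτ
  simp only [Dop, wder_eq_deriv (hf.differentiableAt (isOpen_upperHalfPlane.mem_nhds hτ))]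

theorem differentiableOn_Dop {f : ℂ → ℂ} (hf : DifferentiableOn ℂ f {τ : ℂ | 0 < τ.im}) :
    DifferentiableOn ℂ (Dop f) {τ : ℂ | 0 < τ.im} :=
  ((hf.deriv isOpen_upperHalfPlane).div_const _).congr (Dop_eqOn hf)

theorem differentiableOn_Dop_iterate {f : ℂ → ℂ}
    (hf : DifferentiableOn ℂ f {τ : ℂ | 0 < τ.im}) (j : ℕ) :
    DifferentiableOn ℂ (Dop^[j] f) {τ : ℂ | 0 < τ.im} := by
  induction j with
  | zero => exact hf
  | succ j ih =>
    rw [Function.iterate_succ_apply']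
    exact differentiableOn_Dop ih

/-- Second-order version of `Complex.hasSum_deriv_of_summable_norm`. -/
theorem hasSum_deriv_deriv_of_summable_norm {ι : Type*} {F : ι → ℂ → ℂ} {U : Set ℂ} {z : ℂ}
    {u : ι → ℝ} (hu : Summable u) (hf : ∀ i, DifferentiableOn ℂ (F i) U) (hU : IsOpen U)
    (hF_le : ∀ i, ∀ w ∈ U, ‖F i w‖ ≤ u i) (hz : z ∈ U) :
    HasSum (fun i => deriv (deriv (F i)) z) (deriv (deriv fun w => ∑' i, F i w) z) := by
  have hd (s : Finset ι) : DifferentiableOn ℂ (fun w => ∑ i ∈ s, F i w) U :=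
    DifferentiableOn.fun_sum fun i _ => hf i
  have hc := (((tendstoUniformlyOn_tsum hu hF_le).tendstoLocallyUniformlyOn.deriv
    (Eventually.of_forall hd) hU).deriv
    (Eventually.of_forall fun s => (hd s).deriv hU) hU).tendsto_at hz
  refine hc.congr fun s => ?_
  have h1 : deriv (fun w => ∑ i ∈ s, F i w) =ᶠ[𝓝 z] fun w => ∑ i ∈ s, deriv (F i) w :=
    eventually_of_mem (hU.mem_nhds hz) fun w hw =>
      deriv_fun_sum fun i _ => (hf i).differentiableAt (hU.mem_nhds hw)
  calc deriv (deriv fun w => ∑ i ∈ s, F i w) z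
      = deriv (fun w => ∑ i ∈ s, deriv (F i) w) z := h1.deriv_eq
    _ = ∑ i ∈ s, deriv (deriv (F i)) z :=
      deriv_fun_sum fun i _ => ((hf i).deriv hU).differentiableAt (hU.mem_nhds hz)

theorem summable_thetaBound {m : ℕ} (hm : 0 < m) (a S : ℝ) {T : ℝ} (hT : 0 < T) :
    Summable (thetaBound m a S T) := by
  have hT' : 0 < 2 * (m : ℝ) * T := by positivity
  have h := summable_pow_mul_jacobiTheta₂_term_bound (2 * m * (T * |a| + S)) hT' 0
  simp only [pow_zero, one_mul] at h
  exact h.mul_left _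

theorem norm_thetaTerm_le (m : ℕ) (a : ℝ) {S T : ℝ} (hT : 0 < T) {τ z : ℂ}
    (hτ : T ≤ τ.im) (hz : |z.im| ≤ S) (n : ℤ) :
    ‖thetaTerm m a n τ z‖ ≤ thetaBound m a S T n := by
  have hre : (2 * (Real.pi : ℂ) * Complex.I * (m : ℂ) *
      (((n : ℂ) + (a : ℂ)) ^ 2 * τ + 2 * ((n : ℂ) + (a : ℂ)) * z)).re
      = -(2 * Real.pi * m * ((n + a) ^ 2 * τ.im + 2 * ((n + a) * z.im))) := by
    rw [show 2 * (Real.pi : ℂ) * Complex.I * (m : ℂ) *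
      (((n : ℂ) + (a : ℂ)) ^ 2 * τ + 2 * ((n : ℂ) + (a : ℂ)) * z)
      = ((2 * Real.pi * m * (n + a) ^ 2 : ℝ) : ℂ) * (τ * Complex.I) +
        ((2 * Real.pi * m * (2 * (n + a)) : ℝ) : ℂ) * (z * Complex.I) by push_cast; ring,
      Complex.add_re, Complex.re_ofReal_mul, Complex.re_ofReal_mul, Complex.mul_I_re,
      Complex.mul_I_re]
    ring
  rw [thetaTerm, Complex.norm_exp, hre, thetaBound, ← Real.exp_add, Real.exp_le_exp]
  have h1 : (n + a) ^ 2 * T ≤ (n + a) ^ 2 * τ.im := by gcongr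
  have h2 : (n : ℝ) ^ 2 - 2 * |(n : ℝ)| * |a| ≤ (n + a) ^ 2 := by
    have := neg_abs_le ((n : ℝ) * a)
    rw [abs_mul] at this
    nlinarith [sq_nonneg a]
  have h3 : -((|(n : ℝ)| + |a|) * S) ≤ (n + a) * z.im := by
    have h4 := neg_abs_le (((n : ℝ) + a) * z.im)
    rw [abs_mul] at h4
    have h5 : |(n : ℝ) + a| * |z.im| ≤ (|(n : ℝ)| + |a|) * S := by
      gcongr
      exact abs_add_le _ _
    linarith
  have h6 : ((n : ℝ) ^ 2 - 2 * |(n : ℝ)| * |a|) * T ≤ (n + a) ^ 2 * T := by gcongr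
  have h7 : ((n : ℝ) ^ 2 - 2 * |(n : ℝ)| * |a|) * T - 2 * ((|(n : ℝ)| + |a|) * S)
      ≤ (n + a) ^ 2 * τ.im + 2 * ((n + a) * z.im) := by linarith
  have h8 := mul_le_mul_of_nonneg_left h7 (by positivity : 0 ≤ 2 * Real.pi * m)
  push_cast
  linarith

theorem hasDerivAt_thetaTerm_fst (m : ℕ) (a : ℝ) (n : ℤ) (τ z : ℂ) :
    HasDerivAt (fun w => thetaTerm m a n w z)
      (2 * (Real.pi : ℂ) * Complex.I * m * (n + a) ^ 2 * thetaTerm m a n τ z) τ := by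
  unfold thetaTerm
  have h := ((((hasDerivAt_id τ).const_mul (((n : ℂ) + a) ^ 2)).add_const
    (2 * ((n : ℂ) + a) * z)).const_mul (2 * (Real.pi : ℂ) * Complex.I * m)).cexp
  convert! h using 1
  simp only [id]
  ring

theorem hasDerivAt_thetaTerm_snd (m : ℕ) (a : ℝ) (n : ℤ) (τ z : ℂ) :
    HasDerivAt (thetaTerm m a n τ)
      (4 * (Real.pi : ℂ) * Complex.I * m * (n + a) * thetaTerm m a n τ z) z := by
  unfold thetaTerm
  have h := ((((hasDerivAt_id z).const_mul (2 * ((n : ℂ) + a))).const_add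
    (((n : ℂ) + a) ^ 2 * τ)).const_mul (2 * (Real.pi : ℂ) * Complex.I * m)).cexp
  convert! h using 1
  simp only [id]
  ring

theorem deriv_deriv_thetaTerm_snd (m : ℕ) (a : ℝ) (n : ℤ) (τ z : ℂ) :
    deriv (deriv (thetaTerm m a n τ)) z =
      (4 * (Real.pi : ℂ) * Complex.I * m * (n + a)) ^ 2 * thetaTerm m a n τ z := by
  have h : deriv (thetaTerm m a n τ) =
      fun y => 4 * (Real.pi : ℂ) * Complex.I * m * (n + a) * thetaTerm m a n τ y :=
    funext fun y => (hasDerivAt_thetaTerm_snd m a n τ y).deriv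
  rw [h, ((hasDerivAt_thetaTerm_snd m a n τ z).const_mul _).deriv]
  ring

theorem isOpen_lt_im (T : ℝ) : IsOpen {τ : ℂ | T < τ.im} :=
  isOpen_lt continuous_const Complex.continuous_im

theorem isOpen_abs_im_lt (S : ℝ) : IsOpen {z : ℂ | |z.im| < S} :=
  isOpen_lt Complex.continuous_im.abs continuous_const

theorem differentiableAt_theta_fst {m : ℕ} (hm : 0 < m) (a : ℝ) {τ : ℂ} (hτ : 0 < τ.im) (z : ℂ) :
    DifferentiableAt ℂ (fun w => theta m a w z) τ :=
  (Complex.differentiableOn_tsum_of_summable_norm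
    (summable_thetaBound hm a |z.im| (half_pos hτ))
    (fun n w _ => (hasDerivAt_thetaTerm_fst m a n w z).differentiableAt.differentiableWithinAt)
    (isOpen_lt_im (τ.im / 2))
    fun n _ hw => norm_thetaTerm_le m a (half_pos hτ) (le_of_lt hw) le_rfl n).differentiableAt
      ((isOpen_lt_im (τ.im / 2)).mem_nhds (half_lt_self hτ))

theorem differentiable_theta_snd {m : ℕ} (hm : 0 < m) (a : ℝ) {τ : ℂ} (hτ : 0 < τ.im) :
    Differentiable ℂ (theta m a τ) := fun z =>
  (Complex.differentiableOn_tsum_of_summable_norm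
    (summable_thetaBound hm a (|z.im| + 1) hτ)
    (fun n w _ => (hasDerivAt_thetaTerm_snd m a n τ w).differentiableAt.differentiableWithinAt)
    (isOpen_abs_im_lt (|z.im| + 1))
    fun n _ hw => norm_thetaTerm_le m a hτ le_rfl (le_of_lt hw) n).differentiableAt
      ((isOpen_abs_im_lt (|z.im| + 1)).mem_nhds (lt_add_one |z.im|))

/-- The theta series `θ_{m,a}` is annihilated by the index-`m` heat operator. -/
theorem deriv_deriv_theta_snd {m : ℕ} (hm : 0 < m) (a : ℝ) {τ : ℂ} (hτ : 0 < τ.im) (z : ℂ) :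
    deriv (deriv (theta m a τ)) z =
      8 * (Real.pi : ℂ) * Complex.I * m * deriv (fun w => theta m a w z) τ := by
  have h1 := Complex.hasSum_deriv_of_summable_norm (F := fun n w => thetaTerm m a n w z) (z := τ)
    (summable_thetaBound hm a |z.im| (half_pos hτ))
    (fun n w _ => (hasDerivAt_thetaTerm_fst m a n w z).differentiableAt.differentiableWithinAt)
    (isOpen_lt_im (τ.im / 2))
    (fun n _ hw => norm_thetaTerm_le m a (half_pos hτ) (le_of_lt hw) le_rfl n) (half_lt_self hτ)
  have h2 := hasSum_deriv_deriv_of_summable_norm (F := fun n => thetaTerm m a n τ) (z := z)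
    (summable_thetaBound hm a (|z.im| + 1) hτ)
    (fun n w _ => (hasDerivAt_thetaTerm_snd m a n τ w).differentiableAt.differentiableWithinAt)
    (isOpen_abs_im_lt (|z.im| + 1))
    (fun n _ hw => norm_thetaTerm_le m a hτ le_rfl (le_of_lt hw) n) (lt_add_one |z.im|)
  refine h2.unique ?_
  convert! h1.mul_left (8 * (Real.pi : ℂ) * Complex.I * m) using 2 with n
  rw [deriv_deriv_thetaTerm_snd, (hasDerivAt_thetaTerm_fst m a n τ z).deriv]
  ring

theorem heatOp_const_mul_sum_theta {m : ℕ} (hm : 0 < m) {ι : Type*} [Fintype ι] (b : ι → ℝ)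
    (k : ℂ) {g : ι → ℂ → ℂ} (hg : ∀ i, DifferentiableOn ℂ (g i) {τ : ℂ | 0 < τ.im})
    {τ : ℂ} (hτ : 0 < τ.im) (z : ℂ) :
    heatOp m (fun w y => k * ∑ i, g i w * theta m (b i) w y) τ z =
      -(16 * (Real.pi : ℂ) ^ 2 * (m : ℂ)) * k * ∑ i, Dop (g i) τ * theta m (b i) τ z := by
  have hgd (i : ι) : DifferentiableAt ℂ (g i) τ :=
    (hg i).differentiableAt (isOpen_upperHalfPlane.mem_nhds hτ)
  have hτd : HasDerivAt (fun w => k * ∑ i, g i w * theta m (b i) w z)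
      (k * ∑ i, (deriv (g i) τ * theta m (b i) τ z +
        g i τ * deriv (fun w => theta m (b i) w z) τ)) τ :=
    (HasDerivAt.fun_sum fun i _ => (hgd i).hasDerivAt.mul
      (differentiableAt_theta_fst hm (b i) hτ z).hasDerivAt).const_mul k
  have hzd (y : ℂ) : HasDerivAt (fun y => k * ∑ i, g i τ * theta m (b i) τ y)
      (k * ∑ i, g i τ * deriv (theta m (b i) τ) y) y :=
    (HasDerivAt.fun_sum fun i _ =>
      (differentiable_theta_snd hm (b i) hτ y).hasDerivAt.const_mul _).const_mul k
  have hzw : wder (fun y => k * ∑ i, g i τ * theta m (b i) τ y) =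
      fun y => k * ∑ i, g i τ * deriv (theta m (b i) τ) y := funext fun y => by
    rw [wder_eq_deriv (hzd y).differentiableAt, (hzd y).deriv]
  have hzzd : HasDerivAt (fun y => k * ∑ i, g i τ * deriv (theta m (b i) τ) y)
      (k * ∑ i, g i τ * deriv (deriv (theta m (b i) τ)) z) z :=
    (HasDerivAt.fun_sum fun i _ =>
      (((differentiable_theta_snd hm (b i) hτ).differentiableOn.deriv
        isOpen_univ).differentiableAt univ_mem).hasDerivAt.const_mul _).const_mul k
  rw [heatOp, wder_eq_deriv hτd.differentiableAt, hτd.deriv, hzw,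
    wder_eq_deriv hzzd.differentiableAt, hzzd.deriv]
  simp only [Finset.mul_sum, ← Finset.sum_sub_distrib]
  refine Finset.sum_congr rfl fun i _ => ?_
  rw [deriv_deriv_theta_snd hm (b i) hτ z, Dop_eqOn (hg i) hτ]
  have hpi : (Real.pi : ℂ) ≠ 0 := Complex.ofReal_ne_zero.mpr Real.pi_ne_zero
  have hD : deriv (g i) τ = 2 * (Real.pi : ℂ) * Complex.I *
      (deriv (g i) τ / (2 * (Real.pi : ℂ) * Complex.I)) := by
    field_simp
  set d := deriv (g i) τ / (2 * (Real.pi : ℂ) * Complex.I)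
  rw [hD]
  linear_combination
    (16 * (Real.pi : ℂ) ^ 2 * m * k * d * theta m (b i) τ z) * Complex.I_mul_I

/-- for holomorphic `f_a : ℍ → ℂ`, the `j`-fold iterate of the heat
operator satisfies
`H_m^j(Σ_a f_a(τ)θ_{m,a}(τ,z)) = (−16π²m)^j Σ_a D^j(f_a)(τ) θ_{m,a}(τ,z)` on `ℍ×ℂ`. -/
theorem heatOp_iterate_theta_expansion (m : ℕ) (hm : 0 < m) (j : ℕ) (hj : 1 ≤ j)
    (f : Fin (2 * m) → ℂ → ℂ)
    (hf : ∀ a : Fin (2 * m), DifferentiableOn ℂ (f a) {τ : ℂ | 0 < τ.im})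
    (τ z : ℂ) (hτ : 0 < τ.im) :
    (heatOp m)^[j]
        (fun w y => ∑ a : Fin (2 * m), f a w * theta m (((a : ℕ) : ℝ) / (2 * m)) w y) τ z =
      (-(16 * (Real.pi : ℂ) ^ 2 * (m : ℂ))) ^ j *
        ∑ a : Fin (2 * m), (Dop^[j] (f a)) τ * theta m (((a : ℕ) : ℝ) / (2 * m)) τ z := by
  clear hj
  induction j generalizing τ z with
  | zero => simp
  | succ j ih =>
    rw [Function.iterate_succ_apply', heatOp_congr (fun τ z hτ => ih τ z hτ) hτ z,
      heatOp_const_mul_sum_theta hm _ _ (fun a => differentiableOn_Dop_iterate (hf a) j) hτ z,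
      pow_succ' _ j]
    simp only [Function.iterate_succ_apply']
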